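/- Let u ∈ C_c^∞(ℝ^d, ℂ), n ∈ C^1(ℝ^d, ℝ), f = Δu + n u, and Ψ ∈ C^∞(ℝ^d, ℝ). Then ∫ [∇ū · D²Ψ · ∇u − (1/4)(Δ²Ψ)|u|² + (1/2)(∇n·∇Ψ)|u|²] = −Re ∫ f (∇Ψ·∇ū + (1/2)(ΔΨ)ū). -/

import Mathlib

open scoped ComplexConjugate

/-- The Laplacian of a complex-valued function on `ℝ^d`. -/
noncomputable def lap9 (d : ℕ) (u : EuclideanSpace ℝ (Fin d) → ℂ)
    (x : EuclideanSpace ℝ (Fin d)) : ℂ :=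
  ∑ j : Fin d, iteratedFDeriv ℝ 2 u x
    ![EuclideanSpace.single j 1, EuclideanSpace.single j 1]

open scoped ContDiff
open MeasureTheory

noncomputable def pd9 {d : ℕ} {F : Type*} [NormedAddCommGroup F] [NormedSpace ℝ F] (i : Fin d)
    (g : EuclideanSpace ℝ (Fin d) → F) (x : EuclideanSpace ℝ (Fin d)) : F :=
  fderiv ℝ g x (EuclideanSpace.single i 1)

section
variable {d : ℕ} {F : Type*} [NormedAddCommGroup F] [NormedSpace ℝ F]

lemma pd9_smooth (i : Fin d) {g : EuclideanSpace ℝ (Fin d) → F} (hg : ContDiff ℝ ∞ g) :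
    ContDiff ℝ ∞ (pd9 i g) := by
  unfold pd9
  exact (hg.fderiv_right (m := ∞) (by simp)).clm_apply contDiff_const

lemma pd9_cont (i : Fin d) {g : EuclideanSpace ℝ (Fin d) → F} (hg : ContDiff ℝ 1 g) :
    Continuous (pd9 i g) := by
  unfold pd9
  exact (hg.continuous_fderiv (by simp)).clm_apply continuous_const

lemma pd9_supp (i : Fin d) {g : EuclideanSpace ℝ (Fin d) → F} (hg : HasCompactSupport g) :
    HasCompactSupport (pd9 i g) := by
  unfold pd9
  exact hg.fderiv_apply (𝕜 := ℝ) _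

lemma pd9_has (i : Fin d) {g : EuclideanSpace ℝ (Fin d) → F} (hg : ContDiff ℝ 1 g)
    (x : EuclideanSpace ℝ (Fin d)) :
    HasDerivAt (fun t : ℝ => g (x + t • EuclideanSpace.single i 1)) (pd9 i g x) 0 :=
  ((hg.differentiable (by simp)) x).hasFDerivAt.hasLineDerivAt _

lemma pd9_eq (i : Fin d) {g : EuclideanSpace ℝ (Fin d) → F} (hg : ContDiff ℝ 1 g)
    {x : EuclideanSpace ℝ (Fin d)} {c : F}
    (h : HasDerivAt (fun t : ℝ => g (x + t • EuclideanSpace.single i 1)) c 0) :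
    pd9 i g x = c := (pd9_has i hg x).unique h

lemma pd9_iter (m : ℕ) {g : EuclideanSpace ℝ (Fin d) → F} (hg : ContDiff ℝ ∞ g)
    (x : EuclideanSpace ℝ (Fin d)) (i : Fin d) (v : Fin m → EuclideanSpace ℝ (Fin d)) :
    iteratedFDeriv ℝ (m+1) g x (Matrix.vecCons (EuclideanSpace.single i 1) v)
      = pd9 i (fun y => iteratedFDeriv ℝ m g y v) x := by
  rw [iteratedFDeriv_succ_apply_left]
  unfold pd9
  have h : DifferentiableAt ℝ (iteratedFDeriv ℝ m g) x :=
    (hg.differentiable_iteratedFDeriv (by exact_mod_cast WithTop.coe_lt_top m)) x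
  rw [fderiv_continuousMultilinear_apply_const_apply h]
  simp

lemma pd9_two {g : EuclideanSpace ℝ (Fin d) → F} (hg : ContDiff ℝ ∞ g)
    (x : EuclideanSpace ℝ (Fin d)) (i j : Fin d) :
    iteratedFDeriv ℝ 2 g x ![EuclideanSpace.single i 1, EuclideanSpace.single j 1]
      = pd9 i (pd9 j g) x := by
  rw [pd9_iter 1 hg]
  congr 1; ext y
  rw [pd9_iter 0 hg]
  congr 1

lemma pd9_four {g : EuclideanSpace ℝ (Fin d) → F} (hg : ContDiff ℝ ∞ g)
    (x : EuclideanSpace ℝ (Fin d)) (i j k l : Fin d) :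
    iteratedFDeriv ℝ 4 g x ![EuclideanSpace.single i 1, EuclideanSpace.single j 1,
      EuclideanSpace.single k 1, EuclideanSpace.single l 1]
      = pd9 i (pd9 j (pd9 k (pd9 l g))) x := by
  rw [pd9_iter 3 hg]
  congr 1; ext y
  rw [pd9_iter 2 hg]
  congr 1; ext y
  exact pd9_two hg y k l

lemma pd9_comm {g : EuclideanSpace ℝ (Fin d) → F} (hg : ContDiff ℝ ∞ g)
    (x : EuclideanSpace ℝ (Fin d)) (i j : Fin d) :
    pd9 i (pd9 j g) x = pd9 j (pd9 i g) x := by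
  rw [← pd9_two hg, ← pd9_two hg, iteratedFDeriv_two_apply, iteratedFDeriv_two_apply]
  have := (hg.contDiffAt (x := x)).isSymmSndFDerivAt (by
    rw [minSmoothness_of_isRCLikeNormedField]
    exact WithTop.coe_le_coe.mpr (le_top : (2 : ℕ∞) ≤ ⊤))
  exact this _ _

lemma pd9_int (i : Fin d) {g : EuclideanSpace ℝ (Fin d) → ℝ} (hg : ContDiff ℝ 1 g)
    (hs : HasCompactSupport g) : ∫ x, pd9 i g x = 0 := by
  have h := integral_mul_fderiv_eq_neg_fderiv_mul_of_integrable (μ := volume)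
    (f := fun _ : EuclideanSpace ℝ (Fin d) => (1:ℝ)) (g := g) (v := EuclideanSpace.single i 1)
    (by simp) (by
      simp only [one_mul]
      exact (pd9_cont i hg).integrable_of_hasCompactSupport (pd9_supp i hs))
    (by simpa using hg.continuous.integrable_of_hasCompactSupport hs)
    (by intros; fun_prop) (fun x _ => (hg.differentiable (by simp)) x)
  simpa [pd9] using h

/-- The flux vector field. -/
noncomputable def flux9 (w n Ψ L : EuclideanSpace ℝ (Fin d) → ℝ) (j : Fin d)
    (x : EuclideanSpace ℝ (Fin d)) : ℝ :=
  pd9 j w x * ((∑ k, pd9 k Ψ x * pd9 k w x) + 1/2 * (L x * w x))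
    - 1/2 * (pd9 j Ψ x * ∑ k, pd9 k w x * pd9 k w x)
    - 1/4 * (pd9 j L x * (w x * w x)) + 1/2 * (n x * pd9 j Ψ x * (w x * w x))

lemma flux9_smooth {w n Ψ L : EuclideanSpace ℝ (Fin d) → ℝ} (hw : ContDiff ℝ ∞ w)
    (hn : ContDiff ℝ 1 n) (hΨ : ContDiff ℝ ∞ Ψ) (hL : ContDiff ℝ ∞ L) (j : Fin d) :
    ContDiff ℝ 1 (flux9 w n Ψ L j) := by
  have le : (1 : WithTop ℕ∞) ≤ ∞ := by simp
  have h1 := fun k => (pd9_smooth k hw).of_le le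
  have h2 := fun k => (pd9_smooth k hΨ).of_le le
  have h3 := fun k => (pd9_smooth k hL).of_le le
  have h4 := hw.of_le le
  have h5 := hL.of_le le
  unfold flux9
  have h6 : ContDiff ℝ 1 fun x => ∑ k, pd9 k Ψ x * pd9 k w x :=
    ContDiff.sum fun k _ => (h2 k).mul (h1 k)
  have h7 : ContDiff ℝ 1 fun x => ∑ k, pd9 k w x * pd9 k w x :=
    ContDiff.sum fun k _ => (h1 k).mul (h1 k)
  fun_prop

lemma flux9_supp {w n Ψ L : EuclideanSpace ℝ (Fin d) → ℝ} (hw : HasCompactSupport w) (j : Fin d) :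
    HasCompactSupport (flux9 w n Ψ L j) := by
  refine HasCompactSupport.intro (K := tsupport w) hw fun x hx => ?_
  have h0 : w x = 0 := image_eq_zero_of_notMem_tsupport hx
  have h1 : ∀ k, pd9 k w x = 0 := fun k => by
    unfold pd9
    rw [fderiv_of_notMem_tsupport ℝ hx]; rfl
  simp [flux9, h0, h1]

lemma flux9_pd {w n Ψ L : EuclideanSpace ℝ (Fin d) → ℝ} (hw : ContDiff ℝ ∞ w)
    (hn : ContDiff ℝ 1 n) (hΨ : ContDiff ℝ ∞ Ψ) (hL : ContDiff ℝ ∞ L) (j : Fin d)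
    (x : EuclideanSpace ℝ (Fin d)) :
    pd9 j (flux9 w n Ψ L j) x =
      pd9 j (pd9 j w) x * ((∑ k, pd9 k Ψ x * pd9 k w x) + 1/2 * (L x * w x))
      + pd9 j w x * ((∑ k, (pd9 j (pd9 k Ψ) x * pd9 k w x + pd9 k Ψ x * pd9 j (pd9 k w) x))
          + 1/2 * (pd9 j L x * w x + L x * pd9 j w x))
      - 1/2 * (pd9 j (pd9 j Ψ) x * (∑ k, pd9 k w x * pd9 k w x)
          + pd9 j Ψ x * ∑ k, (pd9 j (pd9 k w) x * pd9 k w x + pd9 k w x * pd9 j (pd9 k w) x))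
      - 1/4 * (pd9 j (pd9 j L) x * (w x * w x)
          + pd9 j L x * (pd9 j w x * w x + w x * pd9 j w x))
      + 1/2 * ((pd9 j n x * pd9 j Ψ x + n x * pd9 j (pd9 j Ψ) x) * (w x * w x)
          + n x * pd9 j Ψ x * (pd9 j w x * w x + w x * pd9 j w x)) := by
  apply pd9_eq j (flux9_smooth hw hn hΨ hL j)
  have le : (1 : WithTop ℕ∞) ≤ ∞ := by simp
  have h1 := fun k => pd9_has j ((pd9_smooth k hw).of_le le) x
  have h2 := fun k => pd9_has j ((pd9_smooth k hΨ).of_le le) x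
  have h3 := pd9_has j ((pd9_smooth j hL).of_le le) x
  have h4 := pd9_has j (hw.of_le le) x
  have h5 := pd9_has j (hL.of_le le) x
  have h6 := pd9_has j hn x
  have s1 := HasDerivAt.fun_sum (u := Finset.univ) fun k _ => (h2 k).fun_mul (h1 k)
  have s2 := HasDerivAt.fun_sum (u := Finset.univ) fun k _ => (h1 k).fun_mul (h1 k)
  have H := (((((h1 j).fun_mul (s1.fun_add ((h5.fun_mul h4).const_mul (1/2)))).fun_sub
    (((h2 j).fun_mul s2).const_mul (1/2))).fun_sub ((h3.fun_mul (h4.fun_mul h4)).const_mul (1/4))).fun_add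
    (((h6.fun_mul (h2 j)).fun_mul (h4.fun_mul h4)).const_mul (1/2)))
  simp only [zero_smul, add_zero] at H
  exact H

lemma alg9 (wj Pj nj Lj LLj : Fin d → ℝ) (wjk Pjk : Fin d → Fin d → ℝ) (w n L : ℝ)
    (hs : ∀ j k, wjk j k = wjk k j) (hL : L = ∑ j, Pjk j j) :
    ∑ j, (wjk j j * ((∑ k, Pj k * wj k) + 1/2 * (L * w))
      + wj j * ((∑ k, (Pjk j k * wj k + Pj k * wjk j k)) + 1/2 * (Lj j * w + L * wj j))
      - 1/2 * (Pjk j j * (∑ k, wj k * wj k) + Pj j * ∑ k, (wjk j k * wj k + wj k * wjk j k))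
      - 1/4 * (LLj j * (w * w) + Lj j * (wj j * w + w * wj j))
      + 1/2 * ((nj j * Pj j + n * Pjk j j) * (w * w) + n * Pj j * (wj j * w + w * wj j)))
    = ((∑ i, ∑ j, Pjk i j * wj i * wj j) - 1/4 * (∑ i, LLj i) * w ^ 2
        + 1/2 * (∑ j, nj j * Pj j) * w^2)
      + ((∑ j, wjk j j) + n * w) * ((∑ j, Pj j * wj j) + 1/2 * L * w) := by
  have e1 : ∑ j, wj j * ∑ k, Pj k * wjk j k = ∑ j, Pj j * ∑ k, wjk j k * wj k := by
    simp_rw [Finset.mul_sum]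
    rw [Finset.sum_comm]
    refine Finset.sum_congr rfl fun j _ => Finset.sum_congr rfl fun k _ => ?_
    rw [hs k j]; ring
  have e2 : ∑ i, ∑ j, Pjk i j * wj i * wj j = ∑ i, wj i * ∑ j, Pjk i j * wj j := by
    simp_rw [Finset.mul_sum]
    refine Finset.sum_congr rfl fun j _ => Finset.sum_congr rfl fun k _ => ?_
    ring
  set A := ∑ k, Pj k * wj k with hA
  set B := ∑ k, wj k * wj k with hB
  rw [e2]
  have key : ∀ j, (wjk j j * (A + 1/2 * (L * w))
      + wj j * ((∑ k, (Pjk j k * wj k + Pj k * wjk j k)) + 1/2 * (Lj j * w + L * wj j))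
      - 1/2 * (Pjk j j * B + Pj j * ∑ k, (wjk j k * wj k + wj k * wjk j k))
      - 1/4 * (LLj j * (w * w) + Lj j * (wj j * w + w * wj j))
      + 1/2 * ((nj j * Pj j + n * Pjk j j) * (w * w) + n * Pj j * (wj j * w + w * wj j)))
      = wjk j j * (A + 1/2 * (L * w)) + wj j * (∑ k, Pjk j k * wj k)
       + (wj j * ∑ k, Pj k * wjk j k) - (Pj j * ∑ k, wjk j k * wj k) 
       + (wj j * wj j) * (1/2 * L) - Pjk j j * (1/2 * B) - LLj j * (1/4 * w^2)
       + (nj j * Pj j) * (1/2 * w^2) + Pjk j j * (1/2 * n * w^2) + (Pj j * wj j) * (n * w) := by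
    intro j
    have : ∑ k, (wjk j k * wj k + wj k * wjk j k) = 2 * ∑ k, wjk j k * wj k := by
      rw [Finset.mul_sum]; exact Finset.sum_congr rfl fun k _ => by ring
    rw [this, Finset.sum_add_distrib]; ring
  simp_rw [key]
  simp only [Finset.sum_add_distrib, Finset.sum_sub_distrib]
  simp_rw [← Finset.sum_mul, ← hA, ← hB, e1, ← hL]
  ring

/-- LHS density for a real function. -/
noncomputable def lhs9 (w n Ψ : EuclideanSpace ℝ (Fin d) → ℝ) (x : EuclideanSpace ℝ (Fin d)) : ℝ :=
  (∑ i, ∑ j, pd9 i (pd9 j Ψ) x * pd9 i w x * pd9 j w x)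
    - 1/4 * (∑ i, ∑ j, pd9 i (pd9 i (pd9 j (pd9 j Ψ))) x) * w x ^ 2
    + 1/2 * (∑ j, pd9 j n x * pd9 j Ψ x) * w x ^ 2

/-- RHS density for a real function. -/
noncomputable def rhs9 (w n Ψ : EuclideanSpace ℝ (Fin d) → ℝ) (x : EuclideanSpace ℝ (Fin d)) : ℝ :=
  ((∑ j, pd9 j (pd9 j w) x) + n x * w x)
    * ((∑ j, pd9 j Ψ x * pd9 j w x) + 1/2 * (∑ j, pd9 j (pd9 j Ψ) x) * w x)

lemma pd9_sum {ι : Type*} [Fintype ι] {g : ι → EuclideanSpace ℝ (Fin d) → F}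
    (hg : ∀ k, ContDiff ℝ ∞ (g k)) (i : Fin d) :
    pd9 i (fun x => ∑ k, g k x) = fun x => ∑ k, pd9 i (g k) x := by
  ext x
  have le : (1 : WithTop ℕ∞) ≤ ∞ := by simp
  refine pd9_eq i (ContDiff.sum fun k _ => (hg k).of_le le) ?_
  exact HasDerivAt.fun_sum fun k _ => pd9_has i ((hg k).of_le le) x

lemma main9 {w n Ψ : EuclideanSpace ℝ (Fin d) → ℝ} (hw : ContDiff ℝ ∞ w)
    (hws : HasCompactSupport w) (hn : ContDiff ℝ 1 n) (hΨ : ContDiff ℝ ∞ Ψ) :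
    ∫ x, (lhs9 w n Ψ x + rhs9 w n Ψ x) = 0 := by
  set L : EuclideanSpace ℝ (Fin d) → ℝ := fun x => ∑ j, pd9 j (pd9 j Ψ) x with hLdef
  have hjj : ∀ j, ContDiff ℝ ∞ (pd9 j (pd9 j Ψ)) := fun j => pd9_smooth j (pd9_smooth j hΨ)
  have hL : ContDiff ℝ ∞ L := ContDiff.sum fun j _ => hjj j
  have hLL : ∀ i x, pd9 i (pd9 i L) x = ∑ j, pd9 i (pd9 i (pd9 j (pd9 j Ψ))) x := by
    intro i x
    rw [hLdef, pd9_sum hjj, pd9_sum fun j => pd9_smooth i (hjj j)]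
  have e : ∀ x, lhs9 w n Ψ x + rhs9 w n Ψ x = ∑ j, pd9 j (flux9 w n Ψ L j) x := by
    intro x
    simp_rw [flux9_pd hw hn hΨ hL]
    rw [alg9 (fun j => pd9 j w x) (fun j => pd9 j Ψ x) (fun j => pd9 j n x) (fun j => pd9 j L x)
      (fun j => pd9 j (pd9 j L) x) (fun j k => pd9 j (pd9 k w) x) (fun j k => pd9 j (pd9 k Ψ) x)
      (w x) (n x) (L x) (fun j k => pd9_comm hw x j k) rfl]
    simp only [hLL]
    rfl
  simp_rw [e]
  rw [integral_finsetSum]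
  · exact Finset.sum_eq_zero fun j _ => pd9_int j (flux9_smooth hw hn hΨ hL j) (flux9_supp hws j)
  · exact fun j _ => (pd9_cont j (flux9_smooth hw hn hΨ hL j)).integrable_of_hasCompactSupport
      (pd9_supp j (flux9_supp hws j))

lemma lhs9_int {w n Ψ : EuclideanSpace ℝ (Fin d) → ℝ} (hw : ContDiff ℝ ∞ w)
    (hws : HasCompactSupport w) (hn : ContDiff ℝ 1 n) (hΨ : ContDiff ℝ ∞ Ψ) :
    Integrable (lhs9 w n Ψ) ∧ Integrable (rhs9 w n Ψ) := by
  have c1 := hw.continuous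
  have c2 := fun i => (pd9_smooth i hw).continuous
  have c3 := fun i => (pd9_smooth i hΨ).continuous
  have c4 := fun i j => (pd9_smooth i (pd9_smooth j hΨ)).continuous
  have c5 := fun i j => (pd9_smooth i (pd9_smooth i (pd9_smooth j (pd9_smooth j hΨ)))).continuous
  have c6 := fun i => pd9_cont i hn
  have c7 := hn.continuous
  have c8 := fun i => (pd9_smooth i (pd9_smooth i hw)).continuous
  have h0 : ∀ x ∉ tsupport w, w x = 0 := fun x hx => image_eq_zero_of_notMem_tsupport hx
  have h1 : ∀ x ∉ tsupport w, ∀ k, pd9 k w x = 0 := fun x hx k => by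
    unfold pd9
    rw [fderiv_of_notMem_tsupport ℝ hx]; rfl
  constructor
  · refine Continuous.integrable_of_hasCompactSupport (by unfold lhs9; fun_prop) ?_
    refine HasCompactSupport.intro (K := tsupport w) hws fun x hx => ?_
    simp [lhs9, h0 x hx, h1 x hx]
  · refine Continuous.integrable_of_hasCompactSupport (by unfold rhs9; fun_prop) ?_
    refine HasCompactSupport.intro (K := tsupport w) hws fun x hx => ?_
    simp [rhs9, h0 x hx, h1 x hx]

lemma pd9_re (i : Fin d) {u : EuclideanSpace ℝ (Fin d) → ℂ} (hu : ContDiff ℝ ∞ u) :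
    pd9 i (fun x => (u x).re) = fun x => (pd9 i u x).re := by
  ext x
  have le : (1 : WithTop ℕ∞) ≤ ∞ := by simp
  refine pd9_eq i ((Complex.reCLM.contDiff.comp hu).of_le le) ?_
  exact Complex.reCLM.hasFDerivAt.comp_hasDerivAt (0:ℝ) (pd9_has i (hu.of_le le) x)

lemma pd9_im (i : Fin d) {u : EuclideanSpace ℝ (Fin d) → ℂ} (hu : ContDiff ℝ ∞ u) :
    pd9 i (fun x => (u x).im) = fun x => (pd9 i u x).im := by
  ext x
  have le : (1 : WithTop ℕ∞) ≤ ∞ := by simp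
  refine pd9_eq i ((Complex.imCLM.contDiff.comp hu).of_le le) ?_
  exact Complex.imCLM.hasFDerivAt.comp_hasDerivAt (0:ℝ) (pd9_has i (hu.of_le le) x)

lemma algL9 (P : Fin d → Fin d → ℝ) (hP : ∀ i j, P i j = P j i) (z : Fin d → ℂ) :
    ∑ i, ∑ j, (P i j : ℂ) * conj (z i) * z j
      = (((∑ i, ∑ j, P i j * (z i).re * (z j).re)
        + ∑ i, ∑ j, P i j * (z i).im * (z j).im : ℝ) : ℂ) := by
  apply Complex.ext
  · simp only [Complex.re_sum, Complex.ofReal_re, ← Finset.sum_add_distrib]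
    refine Finset.sum_congr rfl fun j _ => Finset.sum_congr rfl fun k _ => ?_
    simp
  · have h : ∑ i, ∑ j, P i j * (z i).re * (z j).im = ∑ i, ∑ j, P i j * (z i).im * (z j).re := by
      rw [Finset.sum_comm]
      refine Finset.sum_congr rfl fun j _ => Finset.sum_congr rfl fun k _ => ?_
      rw [hP]; ring
    simp only [Complex.im_sum, Complex.ofReal_im]
    rw [← sub_eq_zero.mpr h]
    simp only [← Finset.sum_sub_distrib]
    refine Finset.sum_congr rfl fun j _ => Finset.sum_congr rfl fun k _ => ?_
    simp
    ring

end

/-- Morawetz multiplier identity (with `ε = 0`): for `f = Δu + nu`,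
`∫ [∇ū·D²Ψ·∇u − (1/4)(Δ²Ψ)|u|² + (1/2)(∇n·∇Ψ)|u|²]
  = −Re ∫ f (∇Ψ·∇ū + (1/2)(ΔΨ)ū)`. -/
theorem stmt_9 (d : ℕ) (u : EuclideanSpace ℝ (Fin d) → ℂ)
    (hu : ContDiff ℝ (⊤ : ℕ∞) u) (hsupp : HasCompactSupport u)
    (n : EuclideanSpace ℝ (Fin d) → ℝ) (hn : ContDiff ℝ 1 n)
    (Ψ : EuclideanSpace ℝ (Fin d) → ℝ) (hΨ : ContDiff ℝ (⊤ : ℕ∞) Ψ)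
    (f : EuclideanSpace ℝ (Fin d) → ℂ)
    (hf : ∀ x, f x = lap9 d u x + n x * u x) :
    (∫ x, ((∑ i : Fin d, ∑ j : Fin d,
          ((iteratedFDeriv ℝ 2 Ψ x
              ![EuclideanSpace.single i 1, EuclideanSpace.single j 1] : ℝ) : ℂ)
            * conj (fderiv ℝ u x (EuclideanSpace.single i 1))
            * fderiv ℝ u x (EuclideanSpace.single j 1))
        - (1 / 4) * ((∑ i : Fin d, ∑ j : Fin d,
            (iteratedFDeriv ℝ 4 Ψ x ![EuclideanSpace.single i 1,
              EuclideanSpace.single i 1, EuclideanSpace.single j 1,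
              EuclideanSpace.single j 1] : ℝ)) : ℂ) * ‖u x‖ ^ 2
        + (1 / 2) * ((∑ j : Fin d, fderiv ℝ n x (EuclideanSpace.single j 1)
            * fderiv ℝ Ψ x (EuclideanSpace.single j 1) : ℝ) : ℂ) * ‖u x‖ ^ 2))
      = -(((∫ x, f x * ((∑ j : Fin d,
            ((fderiv ℝ Ψ x (EuclideanSpace.single j 1) : ℝ) : ℂ)
              * conj (fderiv ℝ u x (EuclideanSpace.single j 1)))
          + (1 / 2) * ((∑ j : Fin d, iteratedFDeriv ℝ 2 Ψ x
              ![EuclideanSpace.single j 1, EuclideanSpace.single j 1] : ℝ) : ℂ)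
            * conj (u x))).re : ℝ) : ℂ) := by
  have hfd : ∀ (g : EuclideanSpace ℝ (Fin d) → ℝ) x j,
    fderiv ℝ g x (EuclideanSpace.single j 1) = pd9 j g x := fun _ _ _ => rfl
  have hfdu : ∀ x j, fderiv ℝ u x (EuclideanSpace.single j 1) = pd9 j u x := fun _ _ => rfl
  simp only [hf, lap9, pd9_two hΨ, pd9_two hu, pd9_four hΨ, hfd, hfdu]
  set a : EuclideanSpace ℝ (Fin d) → ℝ := fun x => (u x).re with ha
  set b : EuclideanSpace ℝ (Fin d) → ℝ := fun x => (u x).im with hb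
  have sa : ContDiff ℝ ∞ a := Complex.reCLM.contDiff.comp hu
  have sb : ContDiff ℝ ∞ b := Complex.imCLM.contDiff.comp hu
  have ka : HasCompactSupport a := hsupp.comp_left (g := Complex.re) rfl
  have kb : HasCompactSupport b := hsupp.comp_left (g := Complex.im) rfl
  have pa : ∀ i x, pd9 i a x = (pd9 i u x).re := fun i x => by rw [ha, pd9_re i hu]
  have pb : ∀ i x, pd9 i b x = (pd9 i u x).im := fun i x => by rw [hb, pd9_im i hu]
  have paa : ∀ i x, pd9 i (pd9 i a) x = (pd9 i (pd9 i u) x).re := fun i x => by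
    rw [ha, pd9_re i hu, pd9_re i (pd9_smooth i hu)]
  have pbb : ∀ i x, pd9 i (pd9 i b) x = (pd9 i (pd9 i u) x).im := fun i x => by
    rw [hb, pd9_im i hu, pd9_im i (pd9_smooth i hu)]
  have nrm : ∀ x, ((‖u x‖ : ℂ)) ^ 2 = ((a x ^ 2 + b x ^ 2 : ℝ) : ℂ) := fun x => by
    rw [← Complex.ofReal_pow, Complex.sq_norm, Complex.normSq_apply]
    congr 1; simp only [ha, hb]; ring
  have E1 : ∀ x, (∑ i : Fin d, ∑ j : Fin d, ((pd9 i (pd9 j Ψ) x : ℝ) : ℂ)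
        * conj (pd9 i u x) * pd9 j u x)
        - (1 / 4) * ((∑ i : Fin d, ∑ j : Fin d, (pd9 i (pd9 i (pd9 j (pd9 j Ψ))) x : ℝ)) : ℂ)
          * ‖u x‖ ^ 2
        + (1 / 2) * ((∑ j : Fin d, pd9 j n x * pd9 j Ψ x : ℝ) : ℂ) * ‖u x‖ ^ 2
      = ((lhs9 a n Ψ x + lhs9 b n Ψ x : ℝ) : ℂ) := by
    intro x
    rw [algL9 _ (fun i j => pd9_comm hΨ x i j), nrm]
    simp only [lhs9, pa, pb]
    push_cast
    ring
  set R : EuclideanSpace ℝ (Fin d) → ℂ := fun x =>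
    (∑ j : Fin d, pd9 j (pd9 j u) x + n x * u x) * ((∑ j : Fin d,
            ((pd9 j Ψ x : ℝ) : ℂ) * conj (pd9 j u x))
          + (1 / 2) * ((∑ j : Fin d, pd9 j (pd9 j Ψ) x : ℝ) : ℂ) * conj (u x)) with hR
  have E2 : ∀ x, (R x).re = rhs9 a n Ψ x + rhs9 b n Ψ x := by
    intro x
    have q : (1 / 2 : ℂ) = ((1/2 : ℝ) : ℂ) := by push_cast; rfl
    simp only [hR, q, rhs9, pa, pb, paa, pbb]
    simp only [Complex.mul_re, Complex.add_re, Complex.add_im, Complex.re_sum, Complex.im_sum,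
      Complex.mul_im, Complex.ofReal_re, Complex.ofReal_im, Complex.conj_re, Complex.conj_im,
      zero_mul, mul_zero, sub_zero, add_zero, mul_neg, Finset.sum_neg_distrib, ha, hb]
    ring
  have hRi : Integrable R := by
    have c1 := hu.continuous
    have c2 := fun i => (pd9_smooth i hu).continuous
    have c3 := fun i => (pd9_smooth i hΨ).continuous
    have c4 := fun i j => (pd9_smooth i (pd9_smooth j hΨ)).continuous
    have c7 := hn.continuous
    have c8 := fun i => (pd9_smooth i (pd9_smooth i hu)).continuous
    refine Continuous.integrable_of_hasCompactSupport ?_ ?_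
    · have c9 : Continuous fun x => conj (u x) := Complex.continuous_conj.comp c1
      have c10 := fun i => Complex.continuous_conj.comp (c2 i)
      have c11 := fun i => Complex.continuous_ofReal.comp (c3 i)
      have c12 : Continuous fun x => ((∑ j : Fin d, pd9 j (pd9 j Ψ) x : ℝ) : ℂ) :=
        Complex.continuous_ofReal.comp (continuous_finsetSum _ fun j _ => c4 j j)
      have c13 : Continuous fun x => ∑ j : Fin d, ((pd9 j Ψ x : ℝ) : ℂ) * conj (pd9 j u x) :=
        continuous_finsetSum _ fun j _ => (c11 j).mul (c10 j)
      have c14 := Complex.continuous_ofReal.comp c7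
      have c15 : Continuous fun x => ∑ j : Fin d, pd9 j (pd9 j u) x :=
        continuous_finsetSum _ fun j _ => c8 j
      exact (c15.add (c14.mul c1)).mul (c13.add ((continuous_const.mul c12).mul c9))
    · refine HasCompactSupport.intro (K := tsupport u) hsupp fun x hx => ?_
      have h0 : u x = 0 := image_eq_zero_of_notMem_tsupport hx
      have h1 : ∀ k, pd9 k u x = 0 := fun k => by
        unfold pd9
        rw [fderiv_of_notMem_tsupport ℝ hx]; rfl
      simp [hR, h0, h1]
  have E3 : (∫ x, R x).re = ∫ x, (R x).re := (integral_re hRi).symm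
  rw [E3]
  simp_rw [E1, E2]
  rw [integral_complex_ofReal, ← Complex.ofReal_neg]
  congr 1
  obtain ⟨ia, ja⟩ := lhs9_int sa ka hn hΨ
  obtain ⟨ib, jb⟩ := lhs9_int sb kb hn hΨ
  have ma := main9 sa ka hn hΨ
  have mb := main9 sb kb hn hΨ
  rw [integral_add ia ja] at ma
  rw [integral_add ib jb] at mb
  rw [integral_add ia ib, integral_add ja jb]
  linarith
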